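/- For all positive integers k and n, the number of domino tilings of the kn × (k+1)n rectangle N(kn,(k+1)n) is odd. -/

import Mathlib

/-- Two cells of `ℤ × ℤ` are adjacent if they differ by `(1,0)` or `(0,1)`. -/
def Adjacent (a b : ℤ × ℤ) : Prop :=
  (a.1 = b.1 ∧ (a.2 = b.2 + 1 ∨ b.2 = a.2 + 1)) ∨
  (a.2 = b.2 ∧ (a.1 = b.1 + 1 ∨ b.1 = a.1 + 1))

/-- `T` is a domino tiling of `R`: a partition of `R` into two-element sets of adjacent cells. -/
def IsDominoTiling (R : Set (ℤ × ℤ)) (T : Set (Set (ℤ × ℤ))) : Prop :=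
  (∀ d ∈ T, ∃ a b, Adjacent a b ∧ d = {a, b}) ∧
  T.PairwiseDisjoint id ∧
  ⋃₀ T = R

/-- The number of domino tilings of `R`. -/
noncomputable def numTilings (R : Set (ℤ × ℤ)) : ℕ :=
  Nat.card {T : Set (Set (ℤ × ℤ)) // IsDominoTiling R T}

/-- The `a × b` rectangle of cells `N(a,b)`. -/
def rectN (a b : ℕ) : Set (ℤ × ℤ) :=
  {q | 0 ≤ q.1 ∧ q.1 < a ∧ 0 ≤ q.2 ∧ q.2 < b}

open Polynomial in
/-- Fibonacci polynomials over `ZMod 2`. -/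
noncomputable def fibU : ℕ → Polynomial (ZMod 2)
  | 0 => 0
  | 1 => 1
  | (n + 2) => Polynomial.X * fibU (n + 1) + fibU n

theorem fibU_add (m n : ℕ) : fibU (m + n + 1) = fibU (m + 1) * fibU (n + 1) + fibU m * fibU n := by
  induction n using Nat.twoStepInduction with
  | zero => simp [fibU]
  | one => simp [fibU]; ring
  | more n h1 h2 =>
    have e : fibU (m + (n + 2) + 1) = Polynomial.X * fibU (m + (n + 1) + 1) + fibU (m + n + 1) := rfl
    have e2 : fibU (n + 2 + 1) = Polynomial.X * fibU (n + 1 + 1) + fibU (n + 1) := rfl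
    have e3 : fibU (n + 2) = Polynomial.X * fibU (n + 1) + fibU n := rfl
    rw [e, h1, h2, e2, e3]
    ring

theorem fibU_cop_succ (m : ℕ) : IsCoprime (fibU m) (fibU (m + 1)) := by
  induction m with
  | zero => simpa [fibU] using isCoprime_one_right
  | succ m ih =>
    have e : fibU (m + 1 + 1) = fibU m + Polynomial.X * fibU (m + 1) := by
      rw [add_comm (fibU m)]; rfl
    rw [e]
    exact (IsCoprime.add_mul_right_left ih Polynomial.X).symm

theorem fibU_cop_add (m n : ℕ) (h : IsCoprime (fibU m) (fibU n)) :
    IsCoprime (fibU m) (fibU (m + n)) := by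
  cases n with
  | zero =>
    simp only [fibU, isCoprime_zero_right] at h
    obtain ⟨u, hu⟩ := h
    rw [← hu]
    exact ⟨↑u⁻¹, 0, by simp⟩
  | succ n =>
    rw [← add_assoc, fibU_add]
    exact IsCoprime.add_mul_left_right ((fibU_cop_succ m).mul_right h) _

theorem fibU_cop (k n : ℕ) : IsCoprime (fibU (k * n + 1)) (fibU ((k + 1) * n + 1)) := by
  have h : IsCoprime (fibU n) (fibU (k * n + 1)) := by
    induction k with
    | zero => simp [fibU, isCoprime_one_right]
    | succ k ih =>
      have := fibU_cop_add _ _ ih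
      rwa [show n + (k * n + 1) = (k + 1) * n + 1 by ring] at this
  have := fibU_cop_add _ _ h.symm
  rwa [show k * n + 1 + n = (k + 1) * n + 1 by ring] at this

/-- Path adjacency operator. -/
def pathT (a : ℕ) : Module.End (ZMod 2) (ℤ → ZMod 2) where
  toFun g i := if 0 ≤ i ∧ i < a then g (i - 1) + g (i + 1) else 0
  map_add' g h := by
    ext i; simp only [Pi.add_apply]; split_ifs
    · ring
    · simp
  map_smul' c g := by
    ext i; simp only [Pi.smul_apply, smul_eq_mul, RingHom.id_apply]; split_ifs
    · ring
    · simp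

theorem seq_eq (T : Module.End (ZMod 2) (ℤ → ZMod 2)) (w : ℕ → (ℤ → ZMod 2)) (c : ℕ)
    (h0 : w 0 = 0) (h : ∀ j < c, w (j + 2) = T (w (j + 1)) + w j) :
    ∀ j ≤ c + 1, w j = Polynomial.aeval T (fibU j) (w 1) := by
  intro j
  induction j using Nat.twoStepInduction with
  | zero => simp [fibU, h0]
  | one => simp [fibU]
  | more n h1 h2 =>
    intro hn
    rw [h n (by omega), h2 (by omega), h1 (by omega)]
    simp [fibU]

theorem z2 (x y : ZMod 2) (h : x + y = 0) : x = y := by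
  revert x y; decide

theorem kernel_zero (a b : ℕ) (hc : IsCoprime (fibU (a + 1)) (fibU (b + 1)))
    (F : ℤ × ℤ → ZMod 2) (hF : ∀ p, p ∉ rectN a b → F p = 0)
    (hh : ∀ x y : ℤ, (x, y) ∈ rectN a b →
      F (x + 1, y) + F (x - 1, y) + F (x, y + 1) + F (x, y - 1) = 0) : F = 0 := by
  set T := pathT a with hT
  let v : ℕ → (ℤ → ZMod 2) := fun j i => F (i, (j : ℤ) - 1)
  let e : ℕ → (ℤ → ZMod 2) := fun j i => if i = (j : ℤ) - 1 ∧ 0 ≤ i ∧ i < a then 1 else 0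
  have hv := seq_eq T v b
    (by ext i; apply hF; simp [rectN])
    (by
      intro j hj
      ext i
      by_cases hi : 0 ≤ i ∧ i < a
      · have := hh i j ⟨hi.1, hi.2, by simp, by simpa using hj⟩
        simp only [hT, pathT, v, LinearMap.coe_mk, AddHom.coe_mk, Pi.add_apply, if_pos hi]
        push_cast
        rw [show (j : ℤ) + 2 - 1 = j + 1 by ring, show (j : ℤ) + 1 - 1 = j by ring]
        apply z2
        rw [← this]; ring
      · simp only [hT, pathT, v, LinearMap.coe_mk, AddHom.coe_mk, Pi.add_apply, if_neg hi]
        rw [hF, hF]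
        · simp
        · intro h; exact hi ⟨h.1, h.2.1⟩
        · intro h; exact hi ⟨h.1, h.2.1⟩)
  have he := seq_eq T e a
    (by ext i; simp only [e, Pi.zero_apply]; rw [if_neg]; push_cast; omega)
    (by
      intro j hj
      ext i
      by_cases hi : 0 ≤ i ∧ i < a
      · simp only [hT, pathT, e, LinearMap.coe_mk, AddHom.coe_mk, Pi.add_apply, if_pos hi]
        push_cast
        split_ifs <;> first | omega | decide
      · simp only [hT, pathT, e, LinearMap.coe_mk, AddHom.coe_mk, Pi.add_apply, if_neg hi]
        simp [hi])
  have hea : e (a + 1) = 0 := by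
    ext i; simp only [e, Pi.zero_apply]; rw [if_neg]; push_cast; omega
  have hvb : v (b + 1) = 0 := by
    ext i; apply hF; simp [rectN]
  have hv1 : v 1 = ∑ j ∈ Finset.range a, v 1 (j : ℤ) • e (j + 1) := by
    ext i
    rw [Finset.sum_apply]
    by_cases hi : 0 ≤ i ∧ i < a
    · rw [Finset.sum_eq_single i.toNat]
      · simp [e, hi]
      · intro j _ hj
        have : ¬ (i = j) := by omega
        simp [e, this]
      · intro h; exact absurd (Finset.mem_range.2 (by omega)) h
    · rw [Finset.sum_eq_zero]
      · apply hF
        intro h; exact hi ⟨h.1, h.2.1⟩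
      · intro j _
        simp [e, hi]
  have k1 : Polynomial.aeval T (fibU (a + 1)) (v 1) = 0 := by
    rw [hv1, map_sum]
    apply Finset.sum_eq_zero
    intro j hj
    rw [Finset.mem_range] at hj
    rw [map_smul, he (j + 1) (by omega), ← Module.End.mul_apply, ← map_mul, mul_comm, map_mul,
      Module.End.mul_apply, ← he (a + 1) le_rfl, hea]
    simp
  have k2 : Polynomial.aeval T (fibU (b + 1)) (v 1) = 0 := by
    rw [← hv (b + 1) le_rfl, hvb]
  have k3 : v 1 = 0 := by
    obtain ⟨p, q, hpq⟩ := hc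
    have := congrArg (fun r => Polynomial.aeval T r (v 1)) hpq
    simp only [map_add, map_mul, map_one, LinearMap.add_apply, Module.End.mul_apply, k1, k2,
      map_zero, add_zero, Module.End.one_apply] at this
    exact this.symm
  ext ⟨x, y⟩
  by_cases hxy : (x, y) ∈ rectN a b
  · have h3 := hxy.2.2
    simp only at h3
    have := congrFun (hv (y.toNat + 1) (by omega)) x
    rw [k3, map_zero] at this
    simp only [v] at this
    rw [show ((y.toNat + 1 : ℕ) : ℤ) - 1 = y by omega] at this
    exact this
  · exact hF _ hxy

section det
open Classical

/-- The adjacency matrix mod 2. -/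
noncomputable def adjM (R : Set (ℤ × ℤ)) : Matrix R R (ZMod 2) :=
  Matrix.of fun p q => if Adjacent p.1 q.1 then 1 else 0

theorem Adjacent.symm' {a b : ℤ × ℤ} (h : Adjacent a b) : Adjacent b a := by
  unfold Adjacent at *; omega

theorem Adjacent.ne' {a b : ℤ × ℤ} (h : Adjacent a b) : a ≠ b := by
  rintro rfl; unfold Adjacent at *; omega

theorem det_adjM (R : Set (ℤ × ℤ)) [Fintype R] :
    (adjM R).det = (Nat.card {σ : Equiv.Perm R // (∀ x, Adjacent x.1 (σ x).1) ∧ σ⁻¹ = σ} : ZMod 2) := by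
  have h1 : (adjM R).det = ∑ σ : Equiv.Perm R, if (∀ x, Adjacent x.1 (σ x).1) then (1 : ZMod 2) else 0 := by
    rw [← Matrix.det_transpose, Matrix.det_apply]
    apply Finset.sum_congr rfl
    intro σ _
    have hs : ∀ (u : ℤˣ) (z : ZMod 2), u • z = z := by
      intro u z
      rcases Int.units_eq_one_or u with rfl | rfl
      · simp
      · revert z; decide
    rw [hs]
    simp only [Matrix.transpose_apply, adjM, Matrix.of_apply]
    rw [Finset.prod_ite_zero]
    simp
  rw [h1, Nat.card_eq_fintype_card, Fintype.card_subtype, Finset.cast_card]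
  rw [Finset.sum_filter, ← sub_eq_zero, ← Finset.sum_sub_distrib]
  apply Finset.sum_involution (fun σ _ => σ⁻¹)
  · intro σ _
    have : (∀ x, Adjacent x.1 ((σ⁻¹) x).1) ↔ (∀ x, Adjacent x.1 (σ x).1) := by
      constructor
      · intro h x
        have := h (σ x)
        simp at this
        exact this.symm'
      · intro h x
        have := h (σ⁻¹ x)
        simp at this
        exact this.symm'
    simp only [this, inv_inv, eq_comm (a := σ)]
    split_ifs <;> decide
  · intro σ _ hne heq
    simp [heq] at hne
  · intro σ _; simp
  · intro σ _; simp

theorem numTilings_eq (R : Set (ℤ × ℤ)) :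
    numTilings R = Nat.card {σ : Equiv.Perm R // (∀ x, Adjacent x.1 (σ x).1) ∧ σ⁻¹ = σ} := by
  symm
  unfold numTilings
  have hinv : ∀ σ : Equiv.Perm R, σ⁻¹ = σ → ∀ x, σ (σ x) = x := by
    intro σ h x
    nth_rewrite 1 [← h]
    simp
  let Φ : {σ : Equiv.Perm R // (∀ x, Adjacent x.1 (σ x).1) ∧ σ⁻¹ = σ} →
      {T : Set (Set (ℤ × ℤ)) // IsDominoTiling R T} := fun σ =>
    ⟨{d | ∃ x : R, d = {x.1, (σ.1 x).1}}, by
      obtain ⟨σ, h1, h2⟩ := σ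
      have h2 := hinv σ h2
      refine ⟨?_, ?_, ?_⟩
      · rintro d ⟨x, rfl⟩
        exact ⟨_, _, h1 x, rfl⟩
      · rintro d ⟨x, rfl⟩ d' ⟨y, rfl⟩ hne
        simp only [Function.onFun, id]
        rw [Set.disjoint_left]
        rintro z hz hz'
        apply hne
        simp only [Set.mem_insert_iff, Set.mem_singleton_iff] at hz hz'
        rcases hz with rfl | rfl <;> rcases hz' with h | h <;> rw [← Subtype.ext_iff] at h
        · rw [h]
        · rw [h, h2, Set.pair_comm]
        · rw [← h, h2, Set.pair_comm]
        · rw [σ.injective h]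
      · ext z
        simp only [Set.mem_sUnion, Set.mem_ofPred_eq]
        constructor
        · rintro ⟨d, ⟨x, rfl⟩, rfl | rfl⟩
          · exact x.2
          · exact (σ x).2
        · intro hz
          exact ⟨_, ⟨⟨z, hz⟩, rfl⟩, by simp⟩⟩
  apply Nat.card_congr (Equiv.ofBijective Φ ⟨?_, ?_⟩)
  · rintro ⟨σ, h1, h2⟩ ⟨τ, h3, h4⟩ h
    have h2 := hinv σ h2
    have h4 := hinv τ h4
    have h := congrArg Subtype.val h
    simp only [Φ] at h
    apply Subtype.ext
    ext1 x
    have hx : ({x.1, (σ x).1} : Set (ℤ × ℤ)) ∈ {d | ∃ x : R, d = {x.1, (τ x).1}} := by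
      rw [← h]; exact ⟨x, rfl⟩
    obtain ⟨y, hy⟩ := hx
    have hne := (h1 x).ne'
    rw [Set.pair_eq_pair_iff] at hy
    simp only [← Subtype.ext_iff] at hy
    rcases hy with ⟨rfl, hy⟩ | ⟨hy1, hy2⟩
    · exact hy
    · show σ x = τ x
      rw [hy2, hy1, h4]
  · rintro ⟨T, hT1, hT2, hT3⟩
    have key : ∀ x : R, ∃ y : R, Adjacent x.1 y.1 ∧ ({x.1, y.1} : Set (ℤ × ℤ)) ∈ T := by
      rintro ⟨x, hx⟩
      have hx' := hx
      rw [← hT3] at hx'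
      obtain ⟨d, hd, hxd⟩ := hx'
      obtain ⟨p, q, hpq, rfl⟩ := hT1 d hd
      have hp : p ∈ R := by rw [← hT3]; exact ⟨_, hd, by simp⟩
      have hq : q ∈ R := by rw [← hT3]; exact ⟨_, hd, by simp⟩
      rcases hxd with rfl | rfl
      · exact ⟨⟨q, hq⟩, hpq, hd⟩
      · exact ⟨⟨p, hp⟩, hpq.symm', by rwa [Set.pair_comm]⟩
    choose f hf1 hf2 using key
    have huniq : ∀ d ∈ T, ∀ d' ∈ T, ∀ z, z ∈ d → z ∈ d' → d = d' := by
      intro d hd d' hd' z hz hz'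
      by_contra hne
      exact Set.disjoint_left.1 (hT2 hd hd' hne) hz hz'
    have hff : ∀ x, f (f x) = x := by
      intro x
      have := huniq _ (hf2 x) _ (hf2 (f x)) (f x).1 (by simp) (by simp)
      rw [Set.pair_eq_pair_iff] at this
      simp only [← Subtype.ext_iff] at this
      rcases this with ⟨h, _⟩ | ⟨h, _⟩
      · exact absurd (congrArg Subtype.val h) (hf1 x).ne'
      · exact h.symm
    refine ⟨⟨⟨f, f, hff, hff⟩, hf1, rfl⟩, ?_⟩
    apply Subtype.ext
    ext d
    simp only [Φ, Set.mem_ofPred_eq, Equiv.coe_fn_mk]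
    constructor
    · rintro ⟨x, rfl⟩; exact hf2 x
    · intro hd
      obtain ⟨p, q, hpq, rfl⟩ := hT1 d hd
      have hp : p ∈ R := by rw [← hT3]; exact ⟨_, hd, by simp⟩
      exact ⟨⟨p, hp⟩, huniq _ hd _ (hf2 ⟨p, hp⟩) p (by simp) (by simp)⟩

theorem det_ne (a b : ℕ) [Fintype (rectN a b)] (hc : IsCoprime (fibU (a + 1)) (fibU (b + 1))) :
    (adjM (rectN a b)).det ≠ 0 := by
  intro hdet
  obtain ⟨v, hv, hv0⟩ := Matrix.exists_mulVec_eq_zero_iff.2 hdet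
  apply hv
  let F : ℤ × ℤ → ZMod 2 := fun p => if h : p ∈ rectN a b then v ⟨p, h⟩ else 0
  have hδ : ∀ c, ∑ q : rectN a b, (if q.1 = c then (1 : ZMod 2) else 0) * v q = F c := by
    intro c
    by_cases hcR : c ∈ rectN a b
    · rw [Finset.sum_eq_single ⟨c, hcR⟩]
      · simp [F, hcR]
      · intro q _ hq
        rw [if_neg, zero_mul]
        intro h; exact hq (Subtype.ext h)
      · simp
    · rw [Finset.sum_eq_zero]
      · simp [F, hcR]
      · intro q _
        rw [if_neg, zero_mul]
        rintro rfl; exact hcR q.2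
  have hF : F = 0 := by
    apply kernel_zero a b hc
    · intro p hp; simp [F, hp]
    · intro x y hxy
      have := congrFun hv0 ⟨(x, y), hxy⟩
      simp only [Matrix.mulVec, dotProduct, adjM, Matrix.of_apply, Pi.zero_apply] at this
      rw [← this, ← hδ, ← hδ, ← hδ, ← hδ, ← Finset.sum_add_distrib, ← Finset.sum_add_distrib,
        ← Finset.sum_add_distrib]
      apply Finset.sum_congr rfl
      rintro ⟨⟨p, q⟩, hq⟩ _
      rw [← add_mul, ← add_mul, ← add_mul]
      congr 1
      simp only [Adjacent, Prod.mk.injEq]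
      split_ifs <;> first | omega | (simp only [zero_add, add_zero]; symm; first | exact if_pos (by assumption) | exact if_neg (by assumption))
  ext q
  have := congrFun hF q.1
  simpa [F] using this

theorem rectN_finite (a b : ℕ) : (rectN a b).Finite := by
  apply ((Set.finite_Ico (0 : ℤ) a).prod (Set.finite_Ico (0 : ℤ) b)).subset
  rintro ⟨x, y⟩ ⟨h1, h2, h3, h4⟩
  exact ⟨⟨h1, h2⟩, ⟨h3, h4⟩⟩

end det

theorem rect_kn_odd (k n : ℕ) (hk : 0 < k) (hn : 0 < n) :
    Odd (numTilings (rectN (k * n) ((k + 1) * n))) := by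
  haveI : Fintype (rectN (k * n) ((k + 1) * n)) := (rectN_finite _ _).fintype
  have h := det_ne _ _ (fibU_cop k n)
  rw [det_adjM, ← numTilings_eq] at h
  exact ZMod.natCast_ne_zero_iff_odd.1 h
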